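/- Let (Ω, F, P) be a probability space, G ⊆ F a sub-σ-algebra, 0 ≤ a < b real numbers, and Z : [a,b] × Ω → ℝ^{k×d} a jointly measurable process with E[∫_a^b ‖Z_s‖² ds] < ∞. Define the ℝ^{k×d}-valued random variable Z̄ := (b − a)^{-1} E[∫_a^b Z_s ds | G]. Then for every G-measurable random variable V : Ω → ℝ^{k×d} with E[‖V‖²] < ∞, one has E[∫_a^b ‖Z_s − Z̄‖² ds] ≤ E[∫_a^b ‖Z_s − V‖² ds]; that is, Z̄ is the best approximation of (Z_s)_{s∈[a,b]} by a G-measurable random variable in L²([a,b] × Ω). -/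

import Mathlib

open MeasureTheory

/-- Bias-variance decomposition. -/
theorem aux_bias {α E : Type*} [MeasurableSpace α] [NormedAddCommGroup E] [InnerProductSpace ℝ E]
    [CompleteSpace E] (μ : Measure α) [IsFiniteMeasure μ] (h : ℝ) (hh : μ.real Set.univ = h)
    (hpos : 0 < h) (f : α → E) (hf : MemLp f 2 μ) (c : E) :
    ∫ s, ‖f s - c‖ ^ 2 ∂μ = ∫ s, ‖f s - h⁻¹ • ∫ t, f t ∂μ‖ ^ 2 ∂μ
      + h * ‖h⁻¹ • ∫ t, f t ∂μ - c‖ ^ 2 := by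
  set m := h⁻¹ • ∫ t, f t ∂μ with hm
  have hfi : Integrable f μ := hf.integrable one_le_two
  have hfm : MemLp (fun s => f s - m) 2 μ := hf.sub (memLp_const m)
  have h1 : Integrable (fun s => ‖f s - m‖ ^ 2) μ :=
    (memLp_two_iff_integrable_sq_norm hfm.1).1 hfm
  have h0 : ∫ s, (f s - m) ∂μ = 0 := by
    rw [integral_sub hfi (integrable_const m), integral_const, hh, hm, smul_smul,
      mul_inv_cancel₀ hpos.ne', one_smul, sub_self]
  have h2 : Integrable (fun s => inner ℝ (m - c) (f s - m)) μ :=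
    (hfm.integrable one_le_two).const_inner _
  have h3 : ∫ s, inner ℝ (m - c) (f s - m) ∂μ = 0 := by
    rw [integral_inner (hfm.integrable one_le_two), h0, inner_zero_right]
  have : ∀ s, ‖f s - c‖ ^ 2 =
      ‖f s - m‖ ^ 2 + (2 * inner ℝ (m - c) (f s - m) + ‖m - c‖ ^ 2) := by
    intro s
    have : f s - c = (f s - m) + (m - c) := by abel
    rw [this, norm_add_sq_real, real_inner_comm]
    ring
  simp_rw [this]
  have h4 : Integrable (fun s => 2 * inner ℝ (m - c) (f s - m) + ‖m - c‖ ^ 2) μ :=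
    (h2.const_mul 2).add (integrable_const _)
  rw [integral_add h1 h4,
    integral_add (h2.const_mul 2) (integrable_const _), integral_const_mul, h3, integral_const, hh]
  simp

theorem aux_bias_lintegral {α E : Type*} [MeasurableSpace α] [NormedAddCommGroup E]
    [InnerProductSpace ℝ E]
    [CompleteSpace E] (μ : Measure α) [IsFiniteMeasure μ] (h : ℝ) (hh : μ.real Set.univ = h)
    (hpos : 0 < h) (f : α → E) (hf : MemLp f 2 μ) (c : E) :
    ∫⁻ s, ENNReal.ofReal (‖f s - c‖ ^ 2) ∂μ
      = ∫⁻ s, ENNReal.ofReal (‖f s - h⁻¹ • ∫ t, f t ∂μ‖ ^ 2) ∂μ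
      + ENNReal.ofReal h * ENNReal.ofReal (‖h⁻¹ • ∫ t, f t ∂μ - c‖ ^ 2) := by
  have key : ∀ c : E, Integrable (fun s => ‖f s - c‖ ^ 2) μ := fun c =>
    (memLp_two_iff_integrable_sq_norm (hf.sub (memLp_const c)).1).1 (hf.sub (memLp_const c))
  rw [← ofReal_integral_eq_lintegral_ofReal (key _) (ae_of_all _ fun _ => by positivity),
    ← ofReal_integral_eq_lintegral_ofReal (key _) (ae_of_all _ fun _ => by positivity),
    ← ENNReal.ofReal_mul hpos.le, ← ENNReal.ofReal_add (integral_nonneg fun _ => by positivity)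
      (by positivity), aux_bias μ h hh hpos f hf c]

/-- Conditional expectation is the best `L²` approximation. -/
theorem aux_condExp {Ω E : Type*} [NormedAddCommGroup E] [InnerProductSpace ℝ E]
    [CompleteSpace E] (G : MeasurableSpace Ω) [m0 : MeasurableSpace Ω]
    (P : Measure Ω) [IsProbabilityMeasure P] (hG : G ≤ m0) (X V : Ω → E) (hX : MemLp X 2 P)
    (hV : MemLp V 2 P) (hVm : AEStronglyMeasurable[G] V P) :
    ∫⁻ ω, ENNReal.ofReal (‖X ω - (P[X|G]) ω‖ ^ 2) ∂P ≤
      ∫⁻ ω, ENNReal.ofReal (‖X ω - V ω‖ ^ 2) ∂P := by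
  have : Fact (G ≤ m0) := ⟨hG⟩
  have e : ∀ W : Ω → E, ∫⁻ ω, ENNReal.ofReal (‖X ω - W ω‖ ^ 2) ∂P = eLpNorm (X - W) 2 P ^ 2 := by
    intro W
    have := eLpNorm_nnreal_pow_eq_lintegral (f := X - W) (μ := P) (p := 2) two_ne_zero
    simp only [NNReal.coe_ofNat, ENNReal.coe_ofNat, ENNReal.rpow_ofNat] at this
    rw [this]
    refine lintegral_congr fun ω => ?_
    rw [ENNReal.ofReal_pow (norm_nonneg _), ofReal_norm]
    rfl
  rw [e, e]
  gcongr
  have hc := hX.condExpL2_ae_eq_condExp (𝕜 := ℝ) hG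
  have hmem : hV.toLp V ∈ lpMeas E ℝ G 2 P :=
    mem_lpMeas_iff_aestronglyMeasurable.2 (hVm.congr hV.coeFn_toLp.symm)
  have hmin : ‖hX.toLp X - (condExpL2 E ℝ hG (hX.toLp X) : Lp E 2 P)‖
      ≤ ‖hX.toLp X - hV.toLp V‖ := by
    have := Submodule.starProjection_minimal (U := lpMeas E ℝ G 2 P) (hX.toLp X)
    refine this.le.trans ?_
    exact ciInf_le (f := fun x : lpMeas E ℝ G 2 P => ‖hX.toLp X - (x : Lp E 2 P)‖)
      ⟨0, Set.forall_mem_range.mpr fun _ => norm_nonneg _⟩ ⟨_, hmem⟩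
  have e1 : eLpNorm (X - P[X|G]) 2 P
      = ‖hX.toLp X - (condExpL2 E ℝ hG (hX.toLp X) : Lp E 2 P)‖ₑ := by
    rw [Lp.enorm_def]
    refine eLpNorm_congr_ae ?_
    filter_upwards [hc, hX.coeFn_toLp, Lp.coeFn_sub (hX.toLp X)
      (condExpL2 E ℝ hG (hX.toLp X) : Lp E 2 P)] with ω h1 h2 h3
    rw [h3, Pi.sub_apply, Pi.sub_apply, h1, h2]
  have e2 : eLpNorm (X - V) 2 P = ‖hX.toLp X - hV.toLp V‖ₑ := by
    rw [← edist_eq_enorm_sub, Lp.edist_toLp_toLp]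
  rw [e1, e2]
  rw [← ofReal_norm, ← ofReal_norm]
  exact ENNReal.ofReal_le_ofReal hmin

/-- the time-averaged conditional expectation
`Z̄ = (b-a)⁻¹ E[∫_a^b Z_s ds | G]` is the best approximation of `(Z_s)_{s∈[a,b]}` by a
`G`-measurable square-integrable random variable, in `L²([a,b] × Ω)`.
Here `ℝ^{k×d}` is `EuclideanSpace ℝ (Fin k × Fin d)` (Frobenius norm), the time integral is a
pathwise Bochner integral, and expectations of nonnegative quantities are Lebesgue integrals. -/
theorem stmt1 (k d : ℕ) {Ω : Type*} (G : MeasurableSpace Ω) [m0 : MeasurableSpace Ω]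
    (P : Measure Ω) [IsProbabilityMeasure P] (hG : G ≤ m0)
    (a b : ℝ) (hab : 0 ≤ a) (hab' : a < b)
    (Z : ℝ → Ω → EuclideanSpace ℝ (Fin k × Fin d))
    (hZmeas : Measurable fun p : ℝ × Ω => Z p.1 p.2)
    (hZint : Integrable (fun p : ℝ × Ω => ‖Z p.1 p.2‖ ^ 2)
      ((volume.restrict (Set.Icc a b)).prod P))
    (Zbar : Ω → EuclideanSpace ℝ (Fin k × Fin d))
    (hZbar : Zbar = fun ω =>
      (b - a)⁻¹ • (P[fun ω' => ∫ s in Set.Icc a b, Z s ω'|G]) ω) :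
    ∀ V : Ω → EuclideanSpace ℝ (Fin k × Fin d),
      Measurable[G] V → Integrable (fun ω => ‖V ω‖ ^ 2) P →
      ∫⁻ ω, (∫⁻ s in Set.Icc a b, ENNReal.ofReal (‖Z s ω - Zbar ω‖ ^ 2)) ∂P ≤
        ∫⁻ ω, (∫⁻ s in Set.Icc a b, ENNReal.ofReal (‖Z s ω - V ω‖ ^ 2)) ∂P := by

  intro V hV hVint
  set μ : Measure ℝ := volume.restrict (Set.Icc a b) with hμ
  have hpos : 0 < b - a := sub_pos.2 hab'
  have hh : μ.real Set.univ = b - a := by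
    simp [hμ, measureReal_def, hab'.le]
  have hZs : StronglyMeasurable fun p : ℝ × Ω => Z p.1 p.2 := hZmeas.stronglyMeasurable
  have hL2 : ∀ᵐ ω ∂P, MemLp (fun s => Z s ω) 2 μ := by
    filter_upwards [hZint.prod_left_ae] with ω hω
    refine (memLp_two_iff_integrable_sq_norm ?_).2 hω
    exact (hZs.comp_measurable measurable_prodMk_right).aestronglyMeasurable
  set X : Ω → EuclideanSpace ℝ (Fin k × Fin d) := fun ω => (b - a)⁻¹ • ∫ s, Z s ω ∂μ with hXdef
  have hXs : StronglyMeasurable X := (hZs.integral_prod_left' (μ := μ)).const_smul (b - a)⁻¹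
  have hXL : MemLp X 2 P := by
    refine (memLp_two_iff_integrable_sq_norm hXs.aestronglyMeasurable).2 ?_
    refine (hZint.integral_prod_right.const_mul (b - a)⁻¹).mono'
      (hXs.norm.pow 2).aestronglyMeasurable ?_
    filter_upwards [hL2] with ω hω
    have := aux_bias μ (b - a) hh hpos _ hω 0
    simp only [sub_zero] at this
    rw [Real.norm_of_nonneg (by positivity), this, mul_add, inv_mul_cancel_left₀ hpos.ne']
    have : 0 ≤ (b - a)⁻¹ * ∫ s, ‖Z s ω - (b - a)⁻¹ • ∫ t, Z t ω ∂μ‖ ^ 2 ∂μ :=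
      mul_nonneg (by positivity) (integral_nonneg fun _ => by positivity)
    exact le_add_of_nonneg_left this
  have hVs : StronglyMeasurable[G] V := hV.stronglyMeasurable
  have hVL : MemLp V 2 P :=
    (memLp_two_iff_integrable_sq_norm (hVs.mono hG).aestronglyMeasurable).2 hVint
  have hZb : Zbar =ᵐ[P] P[X|G] := by
    rw [hZbar]
    exact (condExp_smul (μ := P) (b - a)⁻¹ (fun ω => ∫ s, Z s ω ∂μ) G).symm
  have hmA : Measurable fun ω => ∫⁻ s, ENNReal.ofReal (‖Z s ω - X ω‖ ^ 2) ∂μ := by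
    have : Measurable fun p : ℝ × Ω => ENNReal.ofReal (‖Z p.1 p.2 - X p.2‖ ^ 2) :=
      ((hZmeas.sub (hXs.measurable.comp measurable_snd)).norm.pow_const 2).ennreal_ofReal
    exact this.lintegral_prod_left'
  have main : ∀ W : Ω → EuclideanSpace ℝ (Fin k × Fin d),
      ∫⁻ ω, (∫⁻ s, ENNReal.ofReal (‖Z s ω - W ω‖ ^ 2) ∂μ) ∂P =
      ∫⁻ ω, (∫⁻ s, ENNReal.ofReal (‖Z s ω - X ω‖ ^ 2) ∂μ) ∂P +
      ENNReal.ofReal (b - a) * ∫⁻ ω, ENNReal.ofReal (‖X ω - W ω‖ ^ 2) ∂P := by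
    intro W
    rw [← lintegral_const_mul' _ _ ENNReal.ofReal_ne_top, ← lintegral_add_left hmA]
    refine lintegral_congr_ae ?_
    filter_upwards [hL2] with ω hω
    exact aux_bias_lintegral μ (b - a) hh hpos _ hω (W ω)
  rw [main V, main Zbar]
  refine add_le_add le_rfl (mul_le_mul_right ?_ _)
  refine le_trans (le_of_eq ?_) (aux_condExp G P hG X V hXL hVL hVs.aestronglyMeasurable)
  refine lintegral_congr_ae ?_
  filter_upwards [hZb] with ω hω
  rw [hω]
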